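/- arXiv:1608.06875 — 4 statements merged into one kernel-verified Lean document; each statement's English description precedes it below -/
import Mathlib

section
/- Let n ≥ 2 and let D be a torsion-free affine connection on ℝⁿ, given by smooth Christoffel symbols Γ^C_{AB} with Γ^C_{AB} = Γ^C_{BA}, which preserves a volume form (i.e. there is a smooth positive function v on ℝⁿ with ∑_C Γ^C_{AC} = ∂_{x^A}(log v) for all A). Then the ambient metric 𝐠 of D is invertible at every point of Ω = ℝ_{>0} × ℝⁿ × ℝⁿ × ℝ, and its Ricci curvature (computed from its Levi-Civita Christoffel symbols in coordinates) vanishes identically on Ω. In other words, 𝐠 is a globally Ricci-flat Fefferman–Graham ambient metric for the Patterson–Walker metric of D. -/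
open scoped BigOperators

/-- Partial derivative of a function on `ι → ℝ` in coordinate direction `i`. -/
noncomputable def pd {ι : Type} [Fintype ι] [DecidableEq ι] (i : ι)
    (f : (ι → ℝ) → ℝ) (x : ι → ℝ) : ℝ :=
  fderiv ℝ f x (Pi.single i 1)

/-- Ricci curvature of an affine connection given by coefficients `Γ k i j`. -/
noncomputable def ricConn {ι : Type} [Fintype ι] [DecidableEq ι]
    (Γ : ι → ι → ι → (ι → ℝ) → ℝ) (i j : ι) (x : ι → ℝ) : ℝ :=
  (∑ k, pd k (fun y => Γ k i j y) x) - (∑ k, pd i (fun y => Γ k k j y) x)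
    + ∑ k, ∑ l, (Γ k k l x * Γ l i j x - Γ k i l x * Γ l k j x)

/-- Levi-Civita Christoffel symbols of a metric in coordinates. -/
noncomputable def christoffel {ι : Type} [Fintype ι] [DecidableEq ι]
    (G : (ι → ℝ) → Matrix ι ι ℝ) (k i j : ι) (x : ι → ℝ) : ℝ :=
  (1/2) * ∑ l, (G x)⁻¹ k l *
    (pd i (fun y => G y j l) x + pd j (fun y => G y i l) x - pd l (fun y => G y i j) x)

/-- Laplacian of a metric in coordinates, applied to a function. -/
noncomputable def laplacian {ι : Type} [Fintype ι] [DecidableEq ι]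
    (G : (ι → ℝ) → Matrix ι ι ℝ) (F : (ι → ℝ) → ℝ) (x : ι → ℝ) : ℝ :=
  ∑ i, ∑ j, (G x)⁻¹ i j *
    (pd i (fun y => pd j F y) x - ∑ k, christoffel G k i j x * pd k F x)

/-- Lie derivative of a metric along a vector field, in coordinates. -/
noncomputable def lieDeriv {ι : Type} [Fintype ι] [DecidableEq ι]
    (X : ι → (ι → ℝ) → ℝ) (G : (ι → ℝ) → Matrix ι ι ℝ) (i j : ι) (x : ι → ℝ) : ℝ :=
  (∑ k, X k x * pd k (fun y => G y i j) x)
  + (∑ k, pd i (X k) x * G x k j) + ∑ k, pd j (X k) x * G x i k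

/-- Index type for the ambient space: `t`, `x^A`, `p_A`, `ρ`. -/
abbrev AmbIdx (n : ℕ) : Type := Unit ⊕ (Fin n ⊕ (Fin n ⊕ Unit))

def it (n : ℕ) : AmbIdx n := Sum.inl ()
def ix {n : ℕ} (A : Fin n) : AmbIdx n := Sum.inr (Sum.inl A)
def ip {n : ℕ} (A : Fin n) : AmbIdx n := Sum.inr (Sum.inr (Sum.inl A))
def irho (n : ℕ) : AmbIdx n := Sum.inr (Sum.inr (Sum.inr ()))

/-- The `x`-coordinates of an ambient point. -/
def xc {n : ℕ} (u : AmbIdx n → ℝ) : Fin n → ℝ := fun A => u (ix A)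

/-- The ambient metric of the affine connection `Γ`. -/
noncomputable def ambientMetric (n : ℕ) (Γ : Fin n → Fin n → Fin n → (Fin n → ℝ) → ℝ)
    (u : AmbIdx n → ℝ) : Matrix (AmbIdx n) (AmbIdx n) ℝ :=
  Matrix.of fun a b =>
    match a, b with
    | Sum.inl _, Sum.inl _ => 2 * u (irho n)
    | Sum.inl _, Sum.inr (Sum.inr (Sum.inr _)) => u (it n)
    | Sum.inr (Sum.inr (Sum.inr _)), Sum.inl _ => u (it n)
    | Sum.inr (Sum.inl A), Sum.inr (Sum.inr (Sum.inl B)) =>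
        (u (it n))^2 * (if A = B then (1:ℝ) else 0)
    | Sum.inr (Sum.inr (Sum.inl A)), Sum.inr (Sum.inl B) =>
        (u (it n))^2 * (if A = B then (1:ℝ) else 0)
    | Sum.inr (Sum.inl A), Sum.inr (Sum.inl B) =>
        (u (it n))^2 * (-2 * ∑ C, u (ip C) * Γ C A B (xc u)
          + (2 * u (irho n) / ((n:ℝ) - 1)) * ricConn Γ A B (xc u))
    | _, _ => 0

/-- The Patterson–Walker metric of a torsion-free affine connection with
coefficients `Γ`, on the doubled space with coordinates `(x, y)`. -/
noncomputable def pwGen {ι : Type} [Fintype ι] [DecidableEq ι]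
    (Γ : ι → ι → ι → (ι → ℝ) → ℝ) (u : (ι ⊕ ι) → ℝ) : Matrix (ι ⊕ ι) (ι ⊕ ι) ℝ :=
  Matrix.of fun a b =>
    match a, b with
    | Sum.inl i, Sum.inl j => -2 * ∑ k, u (Sum.inr k) * Γ k i j (fun l => u (Sum.inl l))
    | Sum.inl i, Sum.inr j => if i = j then (1:ℝ) else 0
    | Sum.inr i, Sum.inl j => if i = j then (1:ℝ) else 0
    | Sum.inr _, Sum.inr _ => 0

/-- `D` preserves a volume form: there is a smooth positive `v` with
`∑_C Γ^C_{AC} = ∂_A (log v)`. -/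
def PreservesVolume (n : ℕ) (Γ : Fin n → Fin n → Fin n → (Fin n → ℝ) → ℝ) : Prop :=
  ∃ v : (Fin n → ℝ) → ℝ, ContDiff ℝ (⊤ : ℕ∞) v ∧ (∀ x, 0 < v x) ∧
    ∀ (A : Fin n) (x : Fin n → ℝ), (∑ C, Γ C A C x) = pd A (fun y => Real.log (v y)) x

/-- Index type for the Thomas cone: `x^0` and `x^A`. -/
abbrev ThIdx (n : ℕ) : Type := Unit ⊕ Fin n

/-- The Thomas cone connection of the affine connection `Γ`. -/
noncomputable def thomasConn (n : ℕ) (Γ : Fin n → Fin n → Fin n → (Fin n → ℝ) → ℝ) :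
    ThIdx n → ThIdx n → ThIdx n → ((ThIdx n) → ℝ) → ℝ := fun c a b u =>
  match c, a, b with
  | Sum.inr C, Sum.inr A, Sum.inr B => Γ C A B (fun E => u (Sum.inr E))
  | Sum.inl _, Sum.inr A, Sum.inr B =>
      -(u (Sum.inl ()) / ((n:ℝ) - 1)) * ricConn Γ A B (fun E => u (Sum.inr E))
  | Sum.inr B, Sum.inr A, Sum.inl _ => if A = B then 1 / u (Sum.inl ()) else 0
  | Sum.inr B, Sum.inl _, Sum.inr A => if A = B then 1 / u (Sum.inl ()) else 0
  | _, _, _ => 0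

section PartialDerivatives

variable {ι : Type} [Fintype ι] [DecidableEq ι]

theorem pd_const (i : ι) (c : ℝ) (x : ι → ℝ) : pd i (fun _ => c) x = 0 := by
  simp [pd]

theorem pd_coord (i j : ι) (x : ι → ℝ) : pd i (fun y => y j) x = if j = i then 1 else 0 := by
  have h : HasFDerivAt (fun y : ι → ℝ => y j) (ContinuousLinearMap.proj (R := ℝ) j) x :=
    (ContinuousLinearMap.proj (R := ℝ) (φ := fun _ : ι => ℝ) j).hasFDerivAt
  simp [pd, h.fderiv, Pi.single_apply]

theorem pd_add {f g : (ι → ℝ) → ℝ} (i : ι) {x : ι → ℝ} (hf : DifferentiableAt ℝ f x)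
    (hg : DifferentiableAt ℝ g x) : pd i (fun y => f y + g y) x = pd i f x + pd i g x := by
  simp [pd, fderiv_fun_add hf hg]

theorem pd_mul {f g : (ι → ℝ) → ℝ} (i : ι) {x : ι → ℝ} (hf : DifferentiableAt ℝ f x)
    (hg : DifferentiableAt ℝ g x) :
    pd i (fun y => f y * g y) x = f x * pd i g x + g x * pd i f x := by
  simp [pd, fderiv_fun_mul hf hg]

theorem pd_const_mul {f : (ι → ℝ) → ℝ} (i : ι) (c : ℝ) {x : ι → ℝ}
    (hf : DifferentiableAt ℝ f x) : pd i (fun y => c * f y) x = c * pd i f x := by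
  simp [pd, fderiv_const_mul hf]

theorem pd_sum {κ : Type} {s : Finset κ} {f : κ → (ι → ℝ) → ℝ} (i : ι) {x : ι → ℝ}
    (hf : ∀ k ∈ s, DifferentiableAt ℝ (f k) x) :
    pd i (fun y => ∑ k ∈ s, f k y) x = ∑ k ∈ s, pd i (f k) x := by
  simp [pd, fderiv_fun_sum hf]

theorem pd_inv {f : (ι → ℝ) → ℝ} (i : ι) {x : ι → ℝ} (hf : DifferentiableAt ℝ f x)
    (h0 : f x ≠ 0) : pd i (fun y => (f y)⁻¹) x = -pd i f x / f x ^ 2 := by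
  have h := ((hasDerivAt_inv h0).comp_hasFDerivAt x hf.hasFDerivAt).fderiv
  change fderiv ℝ ((fun z : ℝ => z⁻¹) ∘ f) x (Pi.single i 1) = _
  simp only [pd, h, smul_apply, smul_eq_mul]
  ring

theorem pd_congr {f g : (ι → ℝ) → ℝ} (i : ι) {x : ι → ℝ} (h : f =ᶠ[nhds x] g) :
    pd i f x = pd i g x := by
  simp [pd, h.fderiv_eq]

theorem contDiff_pd {f : (ι → ℝ) → ℝ} (i : ι) (hf : ContDiff ℝ (⊤ : ℕ∞) f) :
    ContDiff ℝ (⊤ : ℕ∞) (pd i f) :=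
  (hf.fderiv_right (m := (⊤ : ℕ∞)) (by simp)).clm_apply contDiff_const

theorem pd_pd_comm {f : (ι → ℝ) → ℝ} (i j : ι) (hf : ContDiff ℝ (⊤ : ℕ∞) f) (x : ι → ℝ) :
    pd i (pd j f) x = pd j (pd i f) x := by
  have hd : DifferentiableAt ℝ (fderiv ℝ f) x :=
    (hf.fderiv_right (m := (⊤ : ℕ∞)) (by simp)).differentiable (by simp) x
  have key : ∀ a b : ι, pd a (pd b f) x =
      fderiv ℝ (fderiv ℝ f) x (Pi.single a 1) (Pi.single b 1) := by
    intro a b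
    change fderiv ℝ (fun y => fderiv ℝ f y (Pi.single b 1)) x (Pi.single a 1) = _
    rw [fderiv_clm_apply hd (differentiableAt_const _)]
    simp
  rw [key, key]
  exact (hf.contDiffAt.isSymmSndFDerivAt
    (by simpa using WithTop.coe_le_coe.2 (le_top (a := (2 : ℕ∞))))) _ _

theorem contDiff_ricConn {Γ : ι → ι → ι → (ι → ℝ) → ℝ}
    (hΓ : ∀ c a b, ContDiff ℝ (⊤ : ℕ∞) (Γ c a b)) (a b : ι) :
    ContDiff ℝ (⊤ : ℕ∞) (ricConn Γ a b) := by
  unfold ricConn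
  refine ContDiff.add (ContDiff.sub ?_ ?_) ?_
  · exact ContDiff.sum fun k _ => contDiff_pd k (hΓ k a b)
  · exact ContDiff.sum fun k _ => contDiff_pd a (hΓ k k b)
  · exact ContDiff.sum fun k _ => ContDiff.sum fun l _ =>
      ((hΓ k k l).mul (hΓ l a b)).sub ((hΓ k a l).mul (hΓ l k b))

theorem ricConn_congr {Γ Γ' : ι → ι → ι → (ι → ℝ) → ℝ} {x : ι → ℝ}
    (h : ∀ c a b, Γ c a b =ᶠ[nhds x] Γ' c a b) (a b : ι) :
    ricConn Γ a b x = ricConn Γ' a b x := by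
  unfold ricConn
  simp only [fun c a b => (h c a b).eq_of_nhds]
  congr 2
  · exact Finset.sum_congr rfl fun k _ => pd_congr k (h k a b)
  · exact Finset.sum_congr rfl fun k _ => pd_congr a (h k k b)

end PartialDerivatives

section VolumePreserving

variable {n : ℕ} {Γ : Fin n → Fin n → Fin n → (Fin n → ℝ) → ℝ}

theorem PreservesVolume.pd_trace_comm (hsmooth : ∀ C A B, ContDiff ℝ (⊤ : ℕ∞) (Γ C A B))
    (hvol : PreservesVolume n Γ) (A B : Fin n) (x : Fin n → ℝ) :
    ∑ C, pd A (Γ C B C) x = ∑ C, pd B (Γ C A C) x := by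
  obtain ⟨v, hv, hpos, hlog⟩ := hvol
  have hL : ContDiff ℝ (⊤ : ℕ∞) (fun y => Real.log (v y)) := hv.log fun y => (hpos y).ne'
  have h : ∀ A B, ∑ C, pd A (Γ C B C) x = pd A (pd B fun y => Real.log (v y)) x := by
    intro A B
    rw [← pd_sum A fun C _ => (hsmooth C B C).differentiable (by simp) x]
    exact congrArg (fun f => pd A f x) (funext fun y => hlog B y)
  rw [h, h, pd_pd_comm A B hL]

theorem ricConn_symm (hsmooth : ∀ C A B, ContDiff ℝ (⊤ : ℕ∞) (Γ C A B))
    (hsym : ∀ C A B x, Γ C A B x = Γ C B A x) (hvol : PreservesVolume n Γ)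
    (A B : Fin n) (x : Fin n → ℝ) : ricConn Γ A B x = ricConn Γ B A x := by
  have hs : ∀ C A B, Γ C A B = Γ C B A := fun C A B => funext (hsym C A B)
  unfold ricConn
  congr 1
  · congr 1
    · exact Finset.sum_congr rfl fun C _ => by rw [hs C A B]
    · simpa only [hs _ _ A, hs _ _ B] using hvol.pd_trace_comm hsmooth A B x
  · simp only [Finset.sum_sub_distrib]
    congr 1
    · exact Finset.sum_congr rfl fun C _ => Finset.sum_congr rfl fun E _ => by rw [hs E A B]
    · rw [Finset.sum_comm]
      exact Finset.sum_congr rfl fun C _ => Finset.sum_congr rfl fun E _ => by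
        rw [hs E A C, hs C E B, hs E C A, hs C B E]
        ring

end VolumePreserving

section AmbientCoordinates

variable {n : ℕ}

/-- A function on the ambient space that is linear in the fibre coordinates `p_C` and `ρ`. -/
noncomputable def fiberLinear (f : Fin n → (Fin n → ℝ) → ℝ) (h : (Fin n → ℝ) → ℝ)
    (u : AmbIdx n → ℝ) : ℝ :=
  (∑ C, u (Sum.inr (Sum.inr (Sum.inl C))) * f C (xc u)) +
    u (Sum.inr (Sum.inr (Sum.inr ()))) * h (xc u)

theorem hasFDerivAt_xc (u : AmbIdx n → ℝ) :
    HasFDerivAt (xc (n := n))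
      (ContinuousLinearMap.pi fun A => ContinuousLinearMap.proj (R := ℝ) (ix A)) u :=
  (ContinuousLinearMap.pi (R := ℝ) (φ := fun _ : Fin n => ℝ)
    fun A => ContinuousLinearMap.proj (R := ℝ) (φ := fun _ : AmbIdx n => ℝ) (ix A)).hasFDerivAt

theorem DifferentiableAt.comp_xc {f : (Fin n → ℝ) → ℝ} {u : AmbIdx n → ℝ}
    (hf : DifferentiableAt ℝ f (xc u)) : DifferentiableAt ℝ (fun y => f (xc y)) u :=
  DifferentiableAt.comp u hf (hasFDerivAt_xc u).differentiableAt

theorem pd_comp_xc {f : (Fin n → ℝ) → ℝ} {u : AmbIdx n → ℝ} (i : AmbIdx n)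
    (hf : DifferentiableAt ℝ f (xc u)) :
    pd i (fun y => f (xc y)) u =
      fderiv ℝ f (xc u) (fun A => if ix A = i then 1 else 0) := by
  have h := (hf.hasFDerivAt.comp u (hasFDerivAt_xc u)).fderiv
  change fderiv ℝ (f ∘ xc) u (Pi.single i 1) = _
  rw [h, ContinuousLinearMap.comp_apply]
  congr 1
  ext A
  simp [Pi.single_apply]

theorem pd_x_comp_xc {f : (Fin n → ℝ) → ℝ} {u : AmbIdx n → ℝ} (A : Fin n)
    (hf : DifferentiableAt ℝ f (xc u)) :
    pd (Sum.inr (Sum.inl A)) (fun y => f (xc y)) u = pd A f (xc u) := by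
  rw [pd_comp_xc _ hf, pd]
  congr 1
  ext B
  simp [ix, Pi.single_apply]

theorem pd_comp_xc_eq_zero {f : (Fin n → ℝ) → ℝ} {u : AmbIdx n → ℝ} {i : AmbIdx n}
    (hi : ∀ A, ix A ≠ i) (hf : DifferentiableAt ℝ f (xc u)) :
    pd i (fun y => f (xc y)) u = 0 := by
  rw [pd_comp_xc _ hf]
  simp only [hi, if_false]
  exact map_zero _

theorem pd_t_comp_xc {f : (Fin n → ℝ) → ℝ} {u : AmbIdx n → ℝ}
    (hf : DifferentiableAt ℝ f (xc u)) : pd (Sum.inl ()) (fun y => f (xc y)) u = 0 :=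
  pd_comp_xc_eq_zero (by simp [ix]) hf

theorem pd_p_comp_xc {f : (Fin n → ℝ) → ℝ} {u : AmbIdx n → ℝ} (C : Fin n)
    (hf : DifferentiableAt ℝ f (xc u)) :
    pd (Sum.inr (Sum.inr (Sum.inl C))) (fun y => f (xc y)) u = 0 :=
  pd_comp_xc_eq_zero (by simp [ix]) hf

theorem pd_rho_comp_xc {f : (Fin n → ℝ) → ℝ} {u : AmbIdx n → ℝ}
    (hf : DifferentiableAt ℝ f (xc u)) :
    pd (Sum.inr (Sum.inr (Sum.inr ()))) (fun y => f (xc y)) u = 0 :=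
  pd_comp_xc_eq_zero (by simp [ix]) hf

section FiberLinear

variable {f : Fin n → (Fin n → ℝ) → ℝ} {h : (Fin n → ℝ) → ℝ} {u : AmbIdx n → ℝ}

theorem differentiableAt_fiberLinear (hf : ∀ C, DifferentiableAt ℝ (f C) (xc u))
    (hh : DifferentiableAt ℝ h (xc u)) : DifferentiableAt ℝ (fiberLinear f h) u := by
  unfold fiberLinear
  refine DifferentiableAt.add (DifferentiableAt.fun_sum fun C _ => ?_) ?_
  · exact (differentiableAt_apply _ _).mul (hf C).comp_xc
  · exact (differentiableAt_apply _ _).mul hh.comp_xc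

theorem pd_fiberLinear (i : AmbIdx n) (hf : ∀ C, DifferentiableAt ℝ (f C) (xc u))
    (hh : DifferentiableAt ℝ h (xc u)) :
    pd i (fiberLinear f h) u =
      (∑ C, (u (Sum.inr (Sum.inr (Sum.inl C))) * pd i (fun y => f C (xc y)) u +
        f C (xc u) * if Sum.inr (Sum.inr (Sum.inl C)) = i then 1 else 0)) +
      (u (Sum.inr (Sum.inr (Sum.inr ()))) * pd i (fun y => h (xc y)) u +
        h (xc u) * if Sum.inr (Sum.inr (Sum.inr ())) = i then 1 else 0) := by
  have hp : ∀ C, DifferentiableAt ℝ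
      (fun y : AmbIdx n → ℝ => y (Sum.inr (Sum.inr (Sum.inl C))) * f C (xc y)) u :=
    fun C => (differentiableAt_apply _ _).mul (hf C).comp_xc
  have hr : DifferentiableAt ℝ
      (fun y : AmbIdx n → ℝ => y (Sum.inr (Sum.inr (Sum.inr ()))) * h (xc y)) u :=
    (differentiableAt_apply _ _).mul hh.comp_xc
  unfold fiberLinear
  rw [pd_add i (DifferentiableAt.fun_sum fun C _ => hp C) hr,
    pd_mul i (differentiableAt_apply _ _) hh.comp_xc, pd_coord, pd_sum i fun C _ => hp C]
  congr 1
  refine Finset.sum_congr rfl fun C _ => ?_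
  rw [pd_mul i (differentiableAt_apply _ _) (hf C).comp_xc, pd_coord]

theorem pd_t_fiberLinear (hf : ∀ C, DifferentiableAt ℝ (f C) (xc u))
    (hh : DifferentiableAt ℝ h (xc u)) : pd (Sum.inl ()) (fiberLinear f h) u = 0 := by
  simp [pd_fiberLinear _ hf hh, pd_t_comp_xc (hf _), pd_t_comp_xc hh]

theorem pd_x_fiberLinear (A : Fin n) (hf : ∀ C, DifferentiableAt ℝ (f C) (xc u))
    (hh : DifferentiableAt ℝ h (xc u)) :
    pd (Sum.inr (Sum.inl A)) (fiberLinear f h) u =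
      fiberLinear (fun C => pd A (f C)) (pd A h) u := by
  simp [pd_fiberLinear _ hf hh, pd_x_comp_xc _ (hf _), pd_x_comp_xc _ hh, fiberLinear]

theorem pd_p_fiberLinear (C : Fin n) (hf : ∀ C, DifferentiableAt ℝ (f C) (xc u))
    (hh : DifferentiableAt ℝ h (xc u)) :
    pd (Sum.inr (Sum.inr (Sum.inl C))) (fiberLinear f h) u = f C (xc u) := by
  simp [pd_fiberLinear _ hf hh, pd_p_comp_xc _ (hf _), pd_p_comp_xc _ hh]

theorem pd_rho_fiberLinear (hf : ∀ C, DifferentiableAt ℝ (f C) (xc u))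
    (hh : DifferentiableAt ℝ h (xc u)) :
    pd (Sum.inr (Sum.inr (Sum.inr ()))) (fiberLinear f h) u = h (xc u) := by
  simp [pd_fiberLinear _ hf hh, pd_rho_comp_xc (hf _), pd_rho_comp_xc hh]

end FiberLinear

end AmbientCoordinates

section AmbientGeometry

variable {n : ℕ}

/-- The Ricci curvature of `Γ` divided by `n - 1`. -/
noncomputable def schouten (Γ : Fin n → Fin n → Fin n → (Fin n → ℝ) → ℝ) (A B : Fin n)
    (x : Fin n → ℝ) : ℝ :=
  ricConn Γ A B x / ((n : ℝ) - 1)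

/-- The coefficient of `t² dx^A dx^B` in the ambient metric. -/
noncomputable def horizontalPart (Γ : Fin n → Fin n → Fin n → (Fin n → ℝ) → ℝ) (A B : Fin n) :
    (AmbIdx n → ℝ) → ℝ :=
  fiberLinear (fun C x => -2 * Γ C A B x) (fun x => 2 * schouten Γ A B x)

/-- The derivative of `horizontalPart Γ A B` in the direction `x^E`. -/
noncomputable def horizontalPartDeriv (Γ : Fin n → Fin n → Fin n → (Fin n → ℝ) → ℝ)
    (E A B : Fin n) : (AmbIdx n → ℝ) → ℝ :=
  fiberLinear (fun C => pd E fun x => -2 * Γ C A B x) (pd E fun x => 2 * schouten Γ A B x)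

/-- The first derivatives of the components of the ambient metric. -/
noncomputable def ambientMetricDeriv (Γ : Fin n → Fin n → Fin n → (Fin n → ℝ) → ℝ)
    (c a b : AmbIdx n) (u : AmbIdx n → ℝ) : ℝ :=
  match c, a, b with
  | Sum.inr (Sum.inr (Sum.inr _)), Sum.inl _, Sum.inl _ => 2
  | Sum.inl _, Sum.inl _, Sum.inr (Sum.inr (Sum.inr _)) => 1
  | Sum.inl _, Sum.inr (Sum.inr (Sum.inr _)), Sum.inl _ => 1
  | Sum.inl _, Sum.inr (Sum.inl A), Sum.inr (Sum.inr (Sum.inl B)) =>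
      2 * u (Sum.inl ()) * (if A = B then 1 else 0)
  | Sum.inl _, Sum.inr (Sum.inr (Sum.inl A)), Sum.inr (Sum.inl B) =>
      2 * u (Sum.inl ()) * (if A = B then 1 else 0)
  | Sum.inl _, Sum.inr (Sum.inl A), Sum.inr (Sum.inl B) =>
      2 * u (Sum.inl ()) * horizontalPart Γ A B u
  | Sum.inr (Sum.inl C), Sum.inr (Sum.inl A), Sum.inr (Sum.inl B) =>
      u (Sum.inl ()) ^ 2 * horizontalPartDeriv Γ C A B u
  | Sum.inr (Sum.inr (Sum.inl C)), Sum.inr (Sum.inl A), Sum.inr (Sum.inl B) =>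
      u (Sum.inl ()) ^ 2 * (-2 * Γ C A B (xc u))
  | Sum.inr (Sum.inr (Sum.inr _)), Sum.inr (Sum.inl A), Sum.inr (Sum.inl B) =>
      u (Sum.inl ()) ^ 2 * (2 * schouten Γ A B (xc u))
  | _, _, _ => 0

/-- The inverse of the ambient metric. -/
noncomputable def ambientMetricInv (Γ : Fin n → Fin n → Fin n → (Fin n → ℝ) → ℝ)
    (u : AmbIdx n → ℝ) : Matrix (AmbIdx n) (AmbIdx n) ℝ :=
  Matrix.of fun a b =>
    match a, b with
    | Sum.inl _, Sum.inr (Sum.inr (Sum.inr _)) => (u (Sum.inl ()))⁻¹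
    | Sum.inr (Sum.inr (Sum.inr _)), Sum.inl _ => (u (Sum.inl ()))⁻¹
    | Sum.inr (Sum.inr (Sum.inr _)), Sum.inr (Sum.inr (Sum.inr _)) =>
        -2 * u (Sum.inr (Sum.inr (Sum.inr ()))) * ((u (Sum.inl ()))⁻¹) ^ 2
    | Sum.inr (Sum.inl A), Sum.inr (Sum.inr (Sum.inl B)) =>
        ((u (Sum.inl ()))⁻¹) ^ 2 * (if A = B then 1 else 0)
    | Sum.inr (Sum.inr (Sum.inl A)), Sum.inr (Sum.inl B) =>
        ((u (Sum.inl ()))⁻¹) ^ 2 * (if A = B then 1 else 0)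
    | Sum.inr (Sum.inr (Sum.inl A)), Sum.inr (Sum.inr (Sum.inl B)) =>
        -((u (Sum.inl ()))⁻¹) ^ 2 * horizontalPart Γ A B u
    | _, _ => 0

/-- The Christoffel symbols of the ambient metric. -/
noncomputable def ambientConn (Γ : Fin n → Fin n → Fin n → (Fin n → ℝ) → ℝ)
    (c a b : AmbIdx n) (u : AmbIdx n → ℝ) : ℝ :=
  match c, a, b with
  | Sum.inr (Sum.inr (Sum.inr _)), Sum.inl _, Sum.inr (Sum.inr (Sum.inr _)) => (u (Sum.inl ()))⁻¹
  | Sum.inr (Sum.inr (Sum.inr _)), Sum.inr (Sum.inr (Sum.inr _)), Sum.inl _ => (u (Sum.inl ()))⁻¹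
  | Sum.inr (Sum.inl B), Sum.inl _, Sum.inr (Sum.inl A) =>
      (if A = B then 1 else 0) * (u (Sum.inl ()))⁻¹
  | Sum.inr (Sum.inl B), Sum.inr (Sum.inl A), Sum.inl _ =>
      (if A = B then 1 else 0) * (u (Sum.inl ()))⁻¹
  | Sum.inr (Sum.inr (Sum.inl B)), Sum.inl _, Sum.inr (Sum.inr (Sum.inl A)) =>
      (if A = B then 1 else 0) * (u (Sum.inl ()))⁻¹
  | Sum.inr (Sum.inr (Sum.inl B)), Sum.inr (Sum.inr (Sum.inl A)), Sum.inl _ =>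
      (if A = B then 1 else 0) * (u (Sum.inl ()))⁻¹
  | Sum.inr (Sum.inr (Sum.inl B)), Sum.inr (Sum.inr (Sum.inr _)), Sum.inr (Sum.inl A) =>
      schouten Γ A B (xc u)
  | Sum.inr (Sum.inr (Sum.inl B)), Sum.inr (Sum.inl A), Sum.inr (Sum.inr (Sum.inr _)) =>
      schouten Γ A B (xc u)
  | Sum.inl _, Sum.inr (Sum.inl A), Sum.inr (Sum.inl B) =>
      -u (Sum.inl ()) * schouten Γ A B (xc u)
  | Sum.inr (Sum.inl C), Sum.inr (Sum.inl A), Sum.inr (Sum.inl B) => Γ C A B (xc u)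
  | Sum.inr (Sum.inr (Sum.inl C)), Sum.inr (Sum.inl A), Sum.inr (Sum.inl B) =>
      (1 / 2) * (horizontalPartDeriv Γ A B C u + horizontalPartDeriv Γ B A C u
          - horizontalPartDeriv Γ C A B u)
        - ∑ E, horizontalPart Γ C E u * Γ E A B (xc u)
  | Sum.inr (Sum.inr (Sum.inr _)), Sum.inr (Sum.inl A), Sum.inr (Sum.inl B) =>
      fiberLinear (fun C x => 2 * Γ C A B x) (fun _ => 0) u
  | Sum.inr (Sum.inr (Sum.inr _)), Sum.inr (Sum.inl A), Sum.inr (Sum.inr (Sum.inl B)) =>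
      -(if A = B then 1 else 0)
  | Sum.inr (Sum.inr (Sum.inr _)), Sum.inr (Sum.inr (Sum.inl B)), Sum.inr (Sum.inl A) =>
      -(if A = B then 1 else 0)
  | Sum.inr (Sum.inr (Sum.inl C)), Sum.inr (Sum.inl A), Sum.inr (Sum.inr (Sum.inl B)) =>
      -Γ B A C (xc u)
  | Sum.inr (Sum.inr (Sum.inl C)), Sum.inr (Sum.inr (Sum.inl B)), Sum.inr (Sum.inl A) =>
      -Γ B A C (xc u)
  | _, _, _ => 0

variable {Γ : Fin n → Fin n → Fin n → (Fin n → ℝ) → ℝ}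

theorem ambientMetric_x_x (A B : Fin n) (u : AmbIdx n → ℝ) :
    ambientMetric n Γ u (Sum.inr (Sum.inl A)) (Sum.inr (Sum.inl B)) =
      u (Sum.inl ()) ^ 2 * horizontalPart Γ A B u := by
  simp only [ambientMetric, Matrix.of_apply, horizontalPart, fiberLinear, schouten, it, ip, irho,
    Finset.mul_sum]
  congr 2
  · exact Finset.sum_congr rfl fun C _ => by ring
  · ring

theorem ambientMetric_mul_inv {u : AmbIdx n → ℝ} (ht : u (Sum.inl ()) ≠ 0) :
    ambientMetric n Γ u * ambientMetricInv Γ u = 1 := by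
  ext a b
  rw [Matrix.mul_apply]
  rcases a with ⟨⟩ | A | A | ⟨⟩ <;> rcases b with ⟨⟩ | B | B | ⟨⟩ <;>
    simp [Fintype.sum_sum_type, ambientMetric_x_x] <;>
    simp [ambientMetric, ambientMetricInv, it, irho, Matrix.one_apply] <;>
    field_simp <;> simp

theorem schouten_contDiff (hsmooth : ∀ C A B, ContDiff ℝ (⊤ : ℕ∞) (Γ C A B)) (A B : Fin n) :
    ContDiff ℝ (⊤ : ℕ∞) (schouten Γ A B) :=
  (contDiff_ricConn hsmooth A B).div_const _

theorem horizontalPart_differentiableAt (hsmooth : ∀ C A B, ContDiff ℝ (⊤ : ℕ∞) (Γ C A B))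
    (A B : Fin n) (u : AmbIdx n → ℝ) : DifferentiableAt ℝ (horizontalPart Γ A B) u :=
  differentiableAt_fiberLinear
    (fun C => ((hsmooth C A B).differentiable (by simp) _).const_mul _)
    (((schouten_contDiff hsmooth A B).differentiable (by simp) _).const_mul _)

theorem horizontalPartDeriv_differentiableAt
    (hsmooth : ∀ C A B, ContDiff ℝ (⊤ : ℕ∞) (Γ C A B))
    (E A B : Fin n) (u : AmbIdx n → ℝ) : DifferentiableAt ℝ (horizontalPartDeriv Γ E A B) u :=
  differentiableAt_fiberLinear
    (fun C => (contDiff_pd E (contDiff_const.mul (hsmooth C A B))).differentiable (by simp) _)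
    ((contDiff_pd E (contDiff_const.mul (schouten_contDiff hsmooth A B))).differentiable
      (by simp) _)

theorem pd_horizontalPart (hsmooth : ∀ C A B, ContDiff ℝ (⊤ : ℕ∞) (Γ C A B))
    (c : AmbIdx n) (A B : Fin n) (u : AmbIdx n → ℝ) :
    pd c (horizontalPart Γ A B) u =
      match c with
      | Sum.inl _ => 0
      | Sum.inr (Sum.inl E) => horizontalPartDeriv Γ E A B u
      | Sum.inr (Sum.inr (Sum.inl C)) => -2 * Γ C A B (xc u)
      | Sum.inr (Sum.inr (Sum.inr _)) => 2 * schouten Γ A B (xc u) := by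
  have hf : ∀ C, DifferentiableAt ℝ (fun x => -2 * Γ C A B x) (xc u) :=
    fun C => ((hsmooth C A B).differentiable (by simp) _).const_mul _
  have hh : DifferentiableAt ℝ (fun x => 2 * schouten Γ A B x) (xc u) :=
    ((schouten_contDiff hsmooth A B).differentiable (by simp) _).const_mul _
  rcases c with ⟨⟩ | E | C | ⟨⟩
  · exact pd_t_fiberLinear hf hh
  · exact pd_x_fiberLinear E hf hh
  · exact pd_p_fiberLinear C hf hh
  · exact pd_rho_fiberLinear hf hh

theorem pd_p_horizontalPartDeriv (hsmooth : ∀ C A B, ContDiff ℝ (⊤ : ℕ∞) (Γ C A B))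
    (C E A B : Fin n) (u : AmbIdx n → ℝ) :
    pd (Sum.inr (Sum.inr (Sum.inl C))) (horizontalPartDeriv Γ E A B) u =
      -2 * pd E (Γ C A B) (xc u) := by
  unfold horizontalPartDeriv
  rw [pd_p_fiberLinear C
    (fun C => (contDiff_pd E (contDiff_const.mul (hsmooth C A B))).differentiable (by simp) _)
    ((contDiff_pd E (contDiff_const.mul (schouten_contDiff hsmooth A B))).differentiable
      (by simp) _),
    pd_const_mul E _ ((hsmooth C A B).differentiable (by simp) _)]

theorem pd_ambientMetric (hsmooth : ∀ C A B, ContDiff ℝ (⊤ : ℕ∞) (Γ C A B))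
    (c a b : AmbIdx n) (u : AmbIdx n → ℝ) :
    pd c (fun y => ambientMetric n Γ y a b) u = ambientMetricDeriv Γ c a b u := by
  have hcoord : ∀ i : AmbIdx n, DifferentiableAt ℝ (fun y : AmbIdx n → ℝ => y i) u :=
    fun i => differentiableAt_apply i u
  have hsq : ∀ (f : (AmbIdx n → ℝ) → ℝ), DifferentiableAt ℝ f u →
      pd c (fun y => y (Sum.inl ()) ^ 2 * f y) u = u (Sum.inl ()) ^ 2 * pd c f u +
        2 * u (Sum.inl ()) * f u * (if c = Sum.inl () then 1 else 0) := by
    intro f hf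
    simp only [pow_two]
    rw [pd_mul c ((hcoord _).fun_mul (hcoord _)) hf, pd_mul c (hcoord _) (hcoord _), pd_coord]
    simp only [eq_comm (a := c)]
    ring
  rcases a with ⟨⟩ | A | A | ⟨⟩ <;> rcases b with ⟨⟩ | B | B | ⟨⟩ <;>
    first
    | simp only [ambientMetric_x_x, hsq _ (horizontalPart_differentiableAt hsmooth A B u),
        pd_horizontalPart hsmooth]
    | simp only [ambientMetric, Matrix.of_apply, pd_const, pd_const_mul c 2 (hcoord _), pd_coord,
        hsq _ (differentiableAt_const _), it, irho]
  all_goals rcases c with ⟨⟩ | C | C | ⟨⟩ <;> unfold ambientMetricDeriv <;> simp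

theorem schouten_symm (hric : ∀ A B x, ricConn Γ A B x = ricConn Γ B A x) (A B : Fin n)
    (x : Fin n → ℝ) : schouten Γ A B x = schouten Γ B A x := by
  simp only [schouten, hric A B]

theorem horizontalPart_symm (hsym : ∀ C A B x, Γ C A B x = Γ C B A x)
    (hric : ∀ A B x, ricConn Γ A B x = ricConn Γ B A x) (A B : Fin n) (u : AmbIdx n → ℝ) :
    horizontalPart Γ A B u = horizontalPart Γ B A u := by
  simp only [horizontalPart, hsym _ A B, schouten_symm hric A B]

theorem fiberLinear_two_mul (A B : Fin n) (u : AmbIdx n → ℝ) :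
    fiberLinear (fun C x => 2 * Γ C A B x) (fun _ => 0) u =
      -horizontalPart Γ A B u + 2 * u (Sum.inr (Sum.inr (Sum.inr ()))) * schouten Γ A B (xc u) := by
  simp only [horizontalPart, fiberLinear, neg_mul, mul_neg, Finset.sum_neg_distrib]
  ring

set_option maxHeartbeats 400000 in
theorem christoffel_ambientMetric (hsmooth : ∀ C A B, ContDiff ℝ (⊤ : ℕ∞) (Γ C A B))
    (hsym : ∀ C A B x, Γ C A B x = Γ C B A x)
    (hric : ∀ A B x, ricConn Γ A B x = ricConn Γ B A x) {u : AmbIdx n → ℝ}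
    (ht : u (Sum.inl ()) ≠ 0) (c a b : AmbIdx n) :
    christoffel (ambientMetric n Γ) c a b u = ambientConn Γ c a b u := by
  have hinv : (ambientMetric n Γ u)⁻¹ = ambientMetricInv Γ u :=
    Matrix.inv_eq_right_inv (ambientMetric_mul_inv ht)
  unfold christoffel
  simp only [hinv, pd_ambientMetric hsmooth]
  rcases a with ⟨⟩ | A | A | ⟨⟩ <;> rcases b with ⟨⟩ | B | B | ⟨⟩ <;>
    rcases c with ⟨⟩ | C | C | ⟨⟩ <;>
    simp only [Fintype.sum_sum_type, Finset.univ_unique, Finset.sum_singleton] <;>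
    unfold ambientMetricDeriv ambientMetricInv ambientConn <;>
    simp <;>
    try field_simp
  all_goals
    first
    | (norm_num; done)
    | (split_ifs <;> simp_all)
    | rw [fiberLinear_two_mul]
    | rw [horizontalPart_symm hsym hric]; ring
    | simp only [mul_assoc, ← Finset.mul_sum]; ring

theorem pd_p_ambientConn_p_x_x (hsmooth : ∀ C A B, ContDiff ℝ (⊤ : ℕ∞) (Γ C A B))
    (u : AmbIdx n → ℝ) (A B C : Fin n) :
    pd (Sum.inr (Sum.inr (Sum.inl C))) (fun y => ambientConn Γ (Sum.inr (Sum.inr (Sum.inl C)))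
        (Sum.inr (Sum.inl A)) (Sum.inr (Sum.inl B)) y) u =
      -pd A (Γ C B C) (xc u) - pd B (Γ C A C) (xc u) + pd C (Γ C A B) (xc u)
        + 2 * ∑ E, Γ C C E (xc u) * Γ E A B (xc u) := by
  have hΓ : ∀ C A B, DifferentiableAt ℝ (Γ C A B) (xc u) :=
    fun C A B => (hsmooth C A B).differentiable (by simp) _
  have hD := fun E A B => horizontalPartDeriv_differentiableAt hsmooth E A B u
  have hH := fun A B => horizontalPart_differentiableAt hsmooth A B u
  simp only [ambientConn, sub_eq_add_neg (_ * _), sub_eq_add_neg (_ + _), ← neg_one_mul (∑ _, _),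
    ← neg_one_mul (horizontalPartDeriv _ _ _ _ _)]
  have h1 := ((hD A B C).fun_add (hD B A C)).fun_add ((hD C A B).const_mul (-1))
  have h2 : ∀ E, DifferentiableAt ℝ (fun y => horizontalPart Γ C E y * Γ E A B (xc y)) u :=
    fun E => (hH C E).fun_mul (hΓ E A B).comp_xc
  rw [pd_add _ (h1.const_mul _) ((DifferentiableAt.fun_sum fun E _ => h2 E).const_mul _),
    pd_const_mul _ _ h1, pd_const_mul _ _ (DifferentiableAt.fun_sum fun E _ => h2 E),
    pd_sum _ fun E _ => h2 E, pd_add _ ((hD A B C).fun_add (hD B A C)) ((hD C A B).const_mul (-1)),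
    pd_add _ (hD A B C) (hD B A C), pd_const_mul _ _ (hD C A B)]
  have h3 : ∀ E, pd (Sum.inr (Sum.inr (Sum.inl C)))
      (fun y => horizontalPart Γ C E y * Γ E A B (xc y)) u =
        -2 * (Γ C C E (xc u) * Γ E A B (xc u)) := by
    intro E
    rw [pd_mul _ (hH C E) (hΓ E A B).comp_xc, pd_p_comp_xc C (hΓ E A B), pd_horizontalPart hsmooth]
    ring
  simp only [h3, pd_p_horizontalPartDeriv hsmooth, ← Finset.mul_sum]
  ring

theorem sum_pd_ambientConn (hsmooth : ∀ C A B, ContDiff ℝ (⊤ : ℕ∞) (Γ C A B))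
    {u : AmbIdx n → ℝ} (ht : u (Sum.inl ()) ≠ 0) (a b : AmbIdx n) :
    ∑ c, pd c (fun y => ambientConn Γ c a b y) u =
      match a, b with
      | Sum.inr (Sum.inl A), Sum.inr (Sum.inl B) =>
          -schouten Γ A B (xc u) + 2 * ∑ C, pd C (Γ C A B) (xc u)
            - ∑ C, pd A (Γ C B C) (xc u) - ∑ C, pd B (Γ C A C) (xc u)
            + 2 * ∑ C, ∑ E, Γ C C E (xc u) * Γ E A B (xc u)
      | _, _ => 0 := by
  have hcoord : ∀ i : AmbIdx n, DifferentiableAt ℝ (fun y : AmbIdx n → ℝ => y i) u :=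
    fun i => differentiableAt_apply i u
  have hΓ : ∀ C A B, DifferentiableAt ℝ (Γ C A B) (xc u) :=
    fun C A B => (hsmooth C A B).differentiable (by simp) _
  have hS : ∀ A B, DifferentiableAt ℝ (schouten Γ A B) (xc u) :=
    fun A B => (schouten_contDiff hsmooth A B).differentiable (by simp) _
  have hinv : ∀ i : AmbIdx n, i ≠ Sum.inl () → pd i (fun y => (y (Sum.inl ()))⁻¹) u = 0 := by
    intro i hi
    rw [pd_inv i (hcoord _) ht, pd_coord, if_neg (Ne.symm hi)]
    simp
  have hite : ∀ (i : AmbIdx n) (A B : Fin n), i ≠ Sum.inl () →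
      pd i (fun y => if A = B then (y (Sum.inl ()))⁻¹ else 0) u = 0 := by
    intro i A B hi
    split_ifs
    exacts [hinv i hi, pd_const i 0 u]
  have hneg : ∀ C A B E,
      pd (Sum.inr (Sum.inr (Sum.inl E))) (fun y => -Γ C A B (xc y)) u = 0 := by
    intro C A B E
    have h := pd_const_mul (Sum.inr (Sum.inr (Sum.inl E))) (-1) (hΓ C A B).comp_xc
    simpa [pd_p_comp_xc E (hΓ C A B)] using h
  have htS : ∀ A B, pd (Sum.inl ()) (fun y => -y (Sum.inl ()) * schouten Γ A B (xc y)) u =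
      -schouten Γ A B (xc u) := by
    intro A B
    have h : (fun y : AmbIdx n → ℝ => -y (Sum.inl ()) * schouten Γ A B (xc y)) =
        fun y => -1 * (y (Sum.inl ()) * schouten Γ A B (xc y)) := by
      funext y
      ring
    rw [h, pd_const_mul _ _ ((hcoord _).fun_mul (hS A B).comp_xc),
      pd_mul _ (hcoord _) (hS A B).comp_xc, pd_coord, pd_t_comp_xc (hS A B)]
    simp
  rcases a with ⟨⟩ | A | A | ⟨⟩ <;> rcases b with ⟨⟩ | B | B | ⟨⟩
  case inr.inl.inr.inl =>
    simp only [Fintype.sum_sum_type, pd_p_ambientConn_p_x_x hsmooth]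
    simp only [ambientConn, Finset.univ_unique, Finset.sum_singleton, htS,
      pd_x_comp_xc _ (hΓ _ _ _),
      pd_rho_fiberLinear (fun C => (hΓ C A B).const_mul 2) (differentiableAt_const (0 : ℝ)),
      Finset.sum_add_distrib, Finset.sum_sub_distrib, Finset.sum_neg_distrib, ← Finset.mul_sum]
    ring
  all_goals
    simp [Fintype.sum_sum_type, ambientConn, pd_const, hinv, hite, hneg, pd_p_comp_xc _ (hS _ _)]

theorem sum_pd_ambientConn_trace (hsmooth : ∀ C A B, ContDiff ℝ (⊤ : ℕ∞) (Γ C A B))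
    (hsym : ∀ C A B x, Γ C A B x = Γ C B A x)
    {u : AmbIdx n → ℝ} (ht : u (Sum.inl ()) ≠ 0) (a b : AmbIdx n) :
    ∑ c, pd a (fun y => ambientConn Γ c c b y) u =
      match a, b with
      | Sum.inl _, Sum.inl _ => -(2 * n + 1) * ((u (Sum.inl ()))⁻¹) ^ 2
      | _, _ => 0 := by
  have hΓ : ∀ C A B, DifferentiableAt ℝ (Γ C A B) (xc u) :=
    fun C A B => (hsmooth C A B).differentiable (by simp) _
  have hneg : ∀ C A B,
      pd a (fun y => -Γ C A B (xc y)) u = -pd a (fun y => Γ C A B (xc y)) u := by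
    intro C A B
    simpa using pd_const_mul a (-1) (hΓ C A B).comp_xc
  have hinv : pd a (fun y => (y (Sum.inl ()))⁻¹) u =
      -(if a = Sum.inl () then 1 else 0) * ((u (Sum.inl ()))⁻¹) ^ 2 := by
    rw [pd_inv a (differentiableAt_apply _ _) ht, pd_coord]
    simp only [eq_comm (a := a)]
    ring
  rcases b with ⟨⟩ | B | B | ⟨⟩
  · rcases a with ⟨⟩ | A | A | ⟨⟩ <;>
      simp [Fintype.sum_sum_type, ambientConn, pd_const, hinv]
    ring
  · simp [Fintype.sum_sum_type, ambientConn, pd_const, hneg, hsym _ B]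
  all_goals simp [ambientConn, pd_const]

theorem sum_ambientConn_trace (hsym : ∀ C A B x, Γ C A B x = Γ C B A x)
    (u : AmbIdx n → ℝ) (b : AmbIdx n) :
    ∑ c, ambientConn Γ c c b u =
      match b with
      | Sum.inl _ => (2 * n + 1) * (u (Sum.inl ()))⁻¹
      | _ => 0 := by
  rcases b with ⟨⟩ | B | B | ⟨⟩
  · simp [Fintype.sum_sum_type, ambientConn]
    ring
  · simp [Fintype.sum_sum_type, ambientConn, hsym _ B]
  all_goals simp [ambientConn]

set_option maxHeartbeats 400000 in
theorem sum_ambientConn_mul_ambientConn (hsym : ∀ C A B x, Γ C A B x = Γ C B A x)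
    (hric : ∀ A B x, ricConn Γ A B x = ricConn Γ B A x)
    {u : AmbIdx n → ℝ} (ht : u (Sum.inl ()) ≠ 0) (a b : AmbIdx n) :
    ∑ c, ∑ d, ambientConn Γ c a d u * ambientConn Γ d c b u =
      match a, b with
      | Sum.inl _, Sum.inl _ => (2 * n + 1) * ((u (Sum.inl ()))⁻¹) ^ 2
      | Sum.inr (Sum.inl A), Sum.inr (Sum.inl B) =>
          -4 * schouten Γ A B (xc u)
            + 2 * ∑ C, ∑ E, Γ C A E (xc u) * Γ E C B (xc u)
      | _, _ => 0 := by
  rcases a with ⟨⟩ | A | A | ⟨⟩ <;> rcases b with ⟨⟩ | B | B | ⟨⟩ <;>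
    simp only [Fintype.sum_sum_type, Finset.univ_unique, Finset.sum_singleton] <;>
    unfold ambientConn <;>
    simp only [mul_zero, zero_mul, Finset.sum_const_zero, add_zero, zero_add]
  case inl.inl =>
    simp
    ring
  case inr.inl.inr.inl =>
    have hq : ∑ C, ∑ E, Γ E A C (xc u) * Γ C B E (xc u) =
        ∑ C, ∑ E, Γ C A E (xc u) * Γ E C B (xc u) := by
      rw [Finset.sum_comm]
      exact Finset.sum_congr rfl fun C _ => Finset.sum_congr rfl fun E _ => by rw [hsym E B C]
    simp [Finset.sum_add_distrib, hq, schouten_symm hric B A]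
    field_simp
    ring
  case inl.inr.inl => simp [hsym _ B]
  case inr.inl.inl => simp [hsym _ A]

theorem ricConn_ambientConn (hn : 2 ≤ n) (hsmooth : ∀ C A B, ContDiff ℝ (⊤ : ℕ∞) (Γ C A B))
    (hsym : ∀ C A B x, Γ C A B x = Γ C B A x) (hvol : PreservesVolume n Γ)
    {u : AmbIdx n → ℝ} (ht : u (Sum.inl ()) ≠ 0) (a b : AmbIdx n) :
    ricConn (ambientConn Γ) a b u = 0 := by
  have hs : ∀ C A B, Γ C A B = Γ C B A := fun C A B => funext (hsym C A B)
  have hric := ricConn_symm hsmooth hsym hvol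
  have htrace : ∑ c, ∑ d, ambientConn Γ c c d u * ambientConn Γ d a b u =
      (2 * n + 1) * (u (Sum.inl ()))⁻¹ * ambientConn Γ (Sum.inl ()) a b u := by
    rw [Finset.sum_comm]
    simp only [← Finset.sum_mul, sum_ambientConn_trace hsym, Fintype.sum_sum_type,
      Finset.univ_unique, Finset.sum_singleton, zero_mul, Finset.sum_const_zero, add_zero]
  unfold ricConn
  rw [sum_pd_ambientConn hsmooth ht, sum_pd_ambientConn_trace hsmooth hsym ht]
  simp only [Finset.sum_sub_distrib]
  rw [htrace, sum_ambientConn_mul_ambientConn hsym hric ht]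
  rcases a with ⟨⟩ | A | A | ⟨⟩ <;> rcases b with ⟨⟩ | B | B | ⟨⟩
  case inr.inl.inr.inl =>
    have hn1 : (n : ℝ) - 1 ≠ 0 := by
      have : (2 : ℝ) ≤ n := by exact_mod_cast hn
      linarith
    have hS : ricConn Γ A B (xc u) = ((n : ℝ) - 1) * schouten Γ A B (xc u) := by
      rw [schouten]
      field_simp
    have hR : ricConn Γ A B (xc u) = ∑ C, pd C (Γ C A B) (xc u) - ∑ C, pd A (Γ C B C) (xc u)
        + (∑ C, ∑ E, Γ C C E (xc u) * Γ E A B (xc u)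
          - ∑ C, ∑ E, Γ C A E (xc u) * Γ E C B (xc u)) := by
      simp only [ricConn, Finset.sum_sub_distrib, hs _ B]
    have hcomm := hvol.pd_trace_comm hsmooth A B (xc u)
    simp only [ambientConn]
    linear_combination 2 * hS - 2 * hR + hcomm
      - (2 * n + 1) * schouten Γ A B (xc u) * inv_mul_cancel₀ ht
  all_goals
    simp only [ambientConn]
    ring

end AmbientGeometry

/-- The ambient metric of a volume-preserving torsion-free affine
connection is everywhere invertible on `Ω = {t > 0}` and globally Ricci-flat there:
it is a global Fefferman–Graham ambient metric for the Patterson–Walker metric. -/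
theorem ambient_metric_global_ricci_flat
    (n : ℕ) (hn : 2 ≤ n) (Γ : Fin n → Fin n → Fin n → (Fin n → ℝ) → ℝ)
    (hsmooth : ∀ C A B, ContDiff ℝ (⊤ : ℕ∞) (Γ C A B))
    (hsym : ∀ C A B x, Γ C A B x = Γ C B A x)
    (hvol : PreservesVolume n Γ) :
    ∀ u : AmbIdx n → ℝ, 0 < u (it n) →
      IsUnit (ambientMetric n Γ u).det ∧
      ∀ i j : AmbIdx n, ricConn (christoffel (ambientMetric n Γ)) i j u = 0 := by
  intro u hu
  have ht : u (Sum.inl ()) ≠ 0 := hu.ne'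
  refine ⟨Matrix.isUnit_det_of_right_inverse (ambientMetric_mul_inv ht), fun i j => ?_⟩
  have hne : ∀ᶠ y : AmbIdx n → ℝ in nhds u, y (Sum.inl ()) ≠ 0 :=
    (continuous_apply _).continuousAt.eventually_ne ht
  have hric := ricConn_symm hsmooth hsym hvol
  rw [ricConn_congr (fun c a b => hne.mono fun y hy =>
    christoffel_ambientMetric hsmooth hsym hric hy c a b) i j]
  exact ricConn_ambientConn hn hsmooth hsym hvol ht i j
end

section
/- Let n ≥ 2 and let D be a torsion-free affine connection on ℝⁿ preserving a volume form, with ambient metric 𝐠 on Ω = ℝ_{>0} × ℝⁿ × ℝⁿ × ℝ. Then the ambient Laplacian annihilates log t: Δ_𝐠(log t) = 0 identically on Ω, where t denotes the first coordinate; consequently every iterated Laplacian Δ_𝐠^m(log t) (m ≥ 1) vanishes identically on Ω. (This is the key computation showing that the Q-curvature of the Patterson–Walker metric of D vanishes, via the Fefferman–Hirachi formula Q_g = −Δ_𝐠ⁿ log t restricted to t = 1, ρ = 0.) -/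
open scoped BigOperators

/-- The partial derivative in direction `i` of a function constant along that direction vanishes. -/
theorem pd_eq_zero_of_const {ι : Type} [Fintype ι] [DecidableEq ι] {i : ι}
    {f : (ι → ℝ) → ℝ} {x : ι → ℝ} (h : ∀ s : ℝ, f (x + s • Pi.single i 1) = f x) :
    pd i f x = 0 := by
  unfold pd
  by_cases hf : DifferentiableAt ℝ f x
  · rw [← hf.lineDeriv_eq_fderiv, lineDeriv]
    simp [h]
  · simp [fderiv_zero_of_not_differentiableAt hf]

/-- Partial derivatives of a function invariant under translation by `a` are again invariant. -/
theorem pd_add_right {ι : Type} [Fintype ι] [DecidableEq ι] (i : ι)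
    {f : (ι → ℝ) → ℝ} {a : ι → ℝ} (h : ∀ y, f (y + a) = f y) (x : ι → ℝ) :
    pd i f (x + a) = pd i f x := by
  have hf : (fun y => f (y + a)) = f := funext h
  unfold pd
  rw [← fderiv_comp_add_right, hf]

/-- Functions that agree near a point have the same Laplacian there. -/
theorem laplacian_congr {ι : Type} [Fintype ι] [DecidableEq ι]
    (G : (ι → ℝ) → Matrix ι ι ℝ) {F F' : (ι → ℝ) → ℝ} {x : ι → ℝ}
    (h : F =ᶠ[nhds x] F') : laplacian G F x = laplacian G F' x := by
  have h1 : ∀ j, (fun y => pd j F y) =ᶠ[nhds x] fun y => pd j F' y := fun j =>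
    (h.fderiv (𝕜 := ℝ)).mono fun y hy => by simp only [pd, hy]
  unfold laplacian
  refine Finset.sum_congr rfl fun i _ => Finset.sum_congr rfl fun j _ => ?_
  have h2 : pd i (fun y => pd j F y) x = pd i (fun y => pd j F' y) x := by
    unfold pd at h1 ⊢
    rw [(h1 j).fderiv_eq]
  simp only [h2, fun k => (h1 k).eq_of_nhds]

theorem laplacian_zero {ι : Type} [Fintype ι] [DecidableEq ι]
    (G : (ι → ℝ) → Matrix ι ι ℝ) (x : ι → ℝ) : laplacian G (fun _ => 0) x = 0 := by
  simp [laplacian, pd]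

/-- The inverse of the ambient metric in coordinates. -/
noncomputable def ambientInverse (n : ℕ) (Γ : Fin n → Fin n → Fin n → (Fin n → ℝ) → ℝ)
    (u : AmbIdx n → ℝ) : Matrix (AmbIdx n) (AmbIdx n) ℝ :=
  Matrix.of fun a b =>
    match a, b with
    | Sum.inl _, Sum.inr (Sum.inr (Sum.inr _)) => (u (it n))⁻¹
    | Sum.inr (Sum.inr (Sum.inr _)), Sum.inl _ => (u (it n))⁻¹
    | Sum.inr (Sum.inr (Sum.inr _)), Sum.inr (Sum.inr (Sum.inr _)) =>
        -2 * u (irho n) * ((u (it n))⁻¹)^2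
    | Sum.inr (Sum.inl A), Sum.inr (Sum.inr (Sum.inl B)) =>
        ((u (it n))⁻¹)^2 * (if A = B then (1:ℝ) else 0)
    | Sum.inr (Sum.inr (Sum.inl A)), Sum.inr (Sum.inl B) =>
        ((u (it n))⁻¹)^2 * (if A = B then (1:ℝ) else 0)
    | Sum.inr (Sum.inr (Sum.inl A)), Sum.inr (Sum.inr (Sum.inl B)) =>
        -((u (it n))⁻¹)^2 * (-2 * ∑ C, u (ip C) * Γ C A B (xc u)
          + (2 * u (irho n) / ((n:ℝ) - 1)) * ricConn Γ A B (xc u))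
    | _, _ => 0

theorem ambientMetric_inv (n : ℕ) (Γ : Fin n → Fin n → Fin n → (Fin n → ℝ) → ℝ)
    (u : AmbIdx n → ℝ) (hu : u (it n) ≠ 0) :
    (ambientMetric n Γ u)⁻¹ = ambientInverse n Γ u := by
  apply Matrix.inv_eq_right_inv
  ext a b
  rw [Matrix.mul_apply]
  rcases a with a | A | A | a <;> rcases b with b | B | B | b <;>
    simp [ambientMetric, ambientInverse, Fintype.sum_sum_type, Matrix.one_apply] <;>
    (try field_simp) <;> (try ring)

theorem christoffel_ambientMetric_it (n : ℕ) (Γ : Fin n → Fin n → Fin n → (Fin n → ℝ) → ℝ)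
    (u : AmbIdx n → ℝ) (hu : u (it n) ≠ 0) (i j : AmbIdx n) :
    christoffel (ambientMetric n Γ) (it n) i j u = (1/2) * ((u (it n))⁻¹ *
      (pd i (fun y => ambientMetric n Γ y j (irho n)) u
        + pd j (fun y => ambientMetric n Γ y i (irho n)) u
        - pd (irho n) (fun y => ambientMetric n Γ y i j) u)) := by
  unfold christoffel
  rw [ambientMetric_inv n Γ u hu]
  simp [Fintype.sum_sum_type, ambientInverse, it, irho]

theorem laplacian_ambientMetric_log (n : ℕ) (Γ : Fin n → Fin n → Fin n → (Fin n → ℝ) → ℝ)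
    (u : AmbIdx n → ℝ) (hu : u (it n) ≠ 0) :
    laplacian (ambientMetric n Γ) (fun w => Real.log (w (it n))) u = 0 := by
  have hF : ∀ k, k ≠ it n → ∀ s : ℝ, ∀ y : AmbIdx n → ℝ,
      Real.log ((y + s • (Pi.single k 1 : AmbIdx n → ℝ)) (it n)) = Real.log (y (it n)) := by
    intro k hk s y
    simp [Pi.single_eq_of_ne hk.symm]
  have h1 : ∀ k, k ≠ it n → ∀ y, pd k (fun w : AmbIdx n → ℝ => Real.log (w (it n))) y = 0 :=
    fun k hk y => pd_eq_zero_of_const fun s => hF k hk s y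
  have h2 : ∀ i j, i ≠ it n ∨ j ≠ it n →
      pd i (fun y => pd j (fun w : AmbIdx n → ℝ => Real.log (w (it n))) y) u = 0 := by
    rintro i j (h | h)
    · exact pd_eq_zero_of_const fun s => pd_add_right j (hF i h s) u
    · rw [funext (h1 j h)]
      exact pd_eq_zero_of_const fun _ => rfl
  have h3 : ∀ i j, ∑ k, christoffel (ambientMetric n Γ) k i j u
        * pd k (fun w : AmbIdx n → ℝ => Real.log (w (it n))) u
      = christoffel (ambientMetric n Γ) (it n) i j u
        * pd (it n) (fun w : AmbIdx n → ℝ => Real.log (w (it n))) u := fun i j =>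
    Finset.sum_eq_single _ (fun k _ hk => by rw [h1 k hk, mul_zero]) (by simp)
  have ht : pd (irho n) (fun y : AmbIdx n → ℝ => y (it n)) u = 0 :=
    pd_eq_zero_of_const fun s => by simp [it, irho]
  have hc : ∀ (i : AmbIdx n) (c : ℝ), pd i (fun _ => c) u = 0 := fun i c =>
    pd_eq_zero_of_const fun _ => rfl
  have hxp : ∀ A B : Fin n,
      pd (irho n) (fun y : AmbIdx n → ℝ => if A = B then y (it n) ^ 2 else 0) u = 0 := fun A B =>
    pd_eq_zero_of_const fun s => by simp [it, irho]
  unfold laplacian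
  rw [ambientMetric_inv n Γ u hu]
  refine Finset.sum_eq_zero fun i _ => Finset.sum_eq_zero fun j _ => ?_
  rw [h3, christoffel_ambientMetric_it n Γ u hu, mul_eq_zero]
  by_cases hij : i ≠ it n ∨ j ≠ it n
  · rw [h2 i j hij]
    rcases i with i | A | A | i <;> rcases j with j | B | B | j <;>
      first
      | (left; rfl)
      | (right; simp only [ambientMetric, Matrix.of_apply, irho] at *; simp [ht, hc, hxp])
  · push Not at hij
    left
    rw [hij.1, hij.2]
    rfl

/-- The ambient Laplacian annihilates `log t` on `Ω`, and hence
every iterated ambient Laplacian of `log t` vanishes on `Ω` (which gives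
vanishing `Q`-curvature of the Patterson–Walker metric via the
Fefferman–Hirachi formula). -/
theorem ambient_laplacian_log_t_zero
    (n : ℕ) (hn : 2 ≤ n) (Γ : Fin n → Fin n → Fin n → (Fin n → ℝ) → ℝ)
    (hsmooth : ∀ C A B, ContDiff ℝ (⊤ : ℕ∞) (Γ C A B))
    (hsym : ∀ C A B x, Γ C A B x = Γ C B A x)
    (hvol : PreservesVolume n Γ) :
    (∀ u : AmbIdx n → ℝ, 0 < u (it n) →
      laplacian (ambientMetric n Γ) (fun w => Real.log (w (it n))) u = 0) ∧
    (∀ m : ℕ, 1 ≤ m → ∀ u : AmbIdx n → ℝ, 0 < u (it n) →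
      ((fun F => laplacian (ambientMetric n Γ) F)^[m]
        (fun w => Real.log (w (it n)))) u = 0) := by
  have key : ∀ u : AmbIdx n → ℝ, 0 < u (it n) →
      laplacian (ambientMetric n Γ) (fun w => Real.log (w (it n))) u = 0 :=
    fun u hu => laplacian_ambientMetric_log n Γ u hu.ne'
  refine ⟨key, fun m hm => ?_⟩
  induction m, hm using Nat.le_induction with
  | base => exact key
  | succ m _ ih =>
    intro u hu
    have hopen : IsOpen {w : AmbIdx n → ℝ | 0 < w (it n)} :=
      isOpen_lt continuous_const (continuous_apply _)
    rw [Function.iterate_succ_apply']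
    exact (laplacian_congr _ (Filter.eventually_of_mem (hopen.mem_nhds hu) ih)).trans
      (laplacian_zero _ u)
end

section
/- Let n ≥ 2 and let D be a torsion-free affine connection on ℝⁿ preserving a volume form, with ambient metric 𝐠 on Ω = ℝ_{>0} × ℝⁿ × ℝⁿ × ℝ. Then the vector field K = t ∂_t − 2 ∑_A p_A ∂_{p_A} − 2ρ ∂_ρ is a Killing field of 𝐠: the Lie derivative satisfies (L_K 𝐠)_{ij} = 0 at every point of Ω and for all indices i, j. -/
open scoped BigOperators

/-- The vector field `K = t ∂_t − 2 p_A ∂_{p_A} − 2 ρ ∂_ρ` on the ambient space. -/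
noncomputable def ambientKillingField (n : ℕ) : AmbIdx n → (AmbIdx n → ℝ) → ℝ := fun k w =>
  match k with
  | Sum.inl _ => w (it n)
  | Sum.inr (Sum.inr (Sum.inl A)) => -2 * w (ip A)
  | Sum.inr (Sum.inr (Sum.inr _)) => -2 * w (irho n)
  | _ => 0

theorem pd_const_mul_apply {ι : Type} [Fintype ι] [DecidableEq ι] (c : ℝ) (i k : ι)
    (x : ι → ℝ) : pd i (fun w => c * w k) x = if k = i then c else 0 := by
  have h : HasFDerivAt (fun w : ι → ℝ => c * w k)
      (c • (ContinuousLinearMap.proj k : (ι → ℝ) →L[ℝ] ℝ)) x :=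
    (ContinuousLinearMap.proj k : (ι → ℝ) →L[ℝ] ℝ).hasFDerivAt.const_mul c
  simp [pd, h.fderiv, Pi.single_apply]

theorem sum_mul_pd {ι : Type} [Fintype ι] [DecidableEq ι] (f : (ι → ℝ) → ℝ) (x v : ι → ℝ) :
    ∑ k, v k * pd k f x = fderiv ℝ f x v := by
  conv_rhs => rw [pi_eq_sum_univ' v]
  simp only [map_sum, map_smul, smul_eq_mul, pd]

/-- The Lie derivative of a metric along a weighted Euler field. -/
theorem lieDeriv_weighted {ι : Type} [Fintype ι] [DecidableEq ι] (c : ι → ℝ)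
    (G : (ι → ℝ) → Matrix ι ι ℝ) (i j : ι) (x : ι → ℝ) :
    lieDeriv (fun k w => c k * w k) G i j x =
      fderiv ℝ (fun y => G y i j) x (fun k => c k * x k) + (c i + c j) * G x i j := by
  have h := sum_mul_pd (fun y => G y i j) x (fun k => c k * x k)
  simp only [lieDeriv, pd_const_mul_apply, ite_mul, zero_mul, Finset.sum_ite_eq',
    Finset.mem_univ, if_true, h]
  ring

theorem fderiv_apply_eq_of_hasDerivAt {E : Type*} [NormedAddCommGroup E] [NormedSpace ℝ E]
    {f : E → ℝ} {x v : E} {d : ℝ} (hf : DifferentiableAt ℝ f x)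
    (h : HasDerivAt (fun s : ℝ => f (x + s • v)) d 0) : fderiv ℝ f x v = d := by
  rw [← hf.lineDeriv_eq_fderiv]
  exact h.deriv

theorem differentiable_pd {ι : Type} [Fintype ι] [DecidableEq ι] {f : (ι → ℝ) → ℝ}
    (hf : ContDiff ℝ (⊤ : ℕ∞) f) (i : ι) : Differentiable ℝ (pd i f) := by
  have h : ContDiff ℝ (⊤ : ℕ∞) (fderiv ℝ f) := hf.fderiv_right (by simp)
  exact (h.differentiable (by simp)).clm_apply (differentiable_const _)

theorem differentiable_ricConn {ι : Type} [Fintype ι] [DecidableEq ι]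
    {Γ : ι → ι → ι → (ι → ℝ) → ℝ} (hΓ : ∀ k i j, ContDiff ℝ (⊤ : ℕ∞) (Γ k i j)) (i j : ι) :
    Differentiable ℝ (ricConn Γ i j) := by
  have hd : ∀ k i j, Differentiable ℝ (Γ k i j) := fun k i j =>
    (hΓ k i j).differentiable (by simp)
  have hp : ∀ l k i j, Differentiable ℝ (pd l (Γ k i j)) := fun l k i j =>
    differentiable_pd (hΓ k i j) l
  unfold ricConn
  fun_prop

theorem differentiable_ambientMetric {n : ℕ} {Γ : Fin n → Fin n → Fin n → (Fin n → ℝ) → ℝ}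
    (hΓ : ∀ C A B, ContDiff ℝ (⊤ : ℕ∞) (Γ C A B)) (i j : AmbIdx n) :
    Differentiable ℝ (fun u => ambientMetric n Γ u i j) := by
  have hx : Differentiable ℝ (xc : (AmbIdx n → ℝ) → Fin n → ℝ) := by
    unfold xc
    fun_prop
  have hd : ∀ C A B, Differentiable ℝ (fun u : AmbIdx n → ℝ => Γ C A B (xc u)) :=
    fun C A B => ((hΓ C A B).differentiable (by simp)).comp hx
  have hr : ∀ A B, Differentiable ℝ (fun u : AmbIdx n → ℝ => ricConn Γ A B (xc u)) :=
    fun A B => (differentiable_ricConn hΓ A B).comp hx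
  rcases i with _ | A | A | _ <;> rcases j with _ | B | B | _ <;>
    simp only [ambientMetric, Matrix.of_apply, div_eq_mul_inv] <;> try fun_prop
  have hs : Differentiable ℝ (fun u : AmbIdx n → ℝ => ∑ C, u (ip C) * Γ C A B (xc u)) :=
    Differentiable.fun_sum fun C _ => (differentiable_apply (ip C)).fun_mul (hd C A B)
  exact Differentiable.fun_mul (by fun_prop)
    ((hs.const_mul (-2)).fun_add (Differentiable.fun_mul (by fun_prop) (hr A B)))

/-- The weights of the ambient coordinates under the flow of the Killing field. -/
def ambientWeight (n : ℕ) : AmbIdx n → ℝ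
  | Sum.inl _ => 1
  | Sum.inr (Sum.inl _) => 0
  | Sum.inr (Sum.inr _) => -2

theorem ambientKillingField_eq (n : ℕ) :
    ambientKillingField n = fun k w => ambientWeight n k * w k := by
  funext k w
  rcases k with _ | A | A | _ <;>
    simp [ambientKillingField, ambientWeight, it, ip, irho]

/-- Each component of the ambient metric is homogeneous for the coordinate weights. -/
theorem hasDerivAt_ambientMetric_weighted {n : ℕ}
    (Γ : Fin n → Fin n → Fin n → (Fin n → ℝ) → ℝ) (i j : AmbIdx n) (u : AmbIdx n → ℝ) :
    HasDerivAt
      (fun s : ℝ => ambientMetric n Γ (u + s • fun k => ambientWeight n k * u k) i j)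
      (-(ambientWeight n i + ambientWeight n j) * ambientMetric n Γ u i j) 0 := by
  have ht : ∀ s : ℝ, (u + s • fun k => ambientWeight n k * u k) (it n) =
      (1 + s) * u (it n) := fun s => by
    simp [ambientWeight, it]; ring
  have hr : ∀ s : ℝ, (u + s • fun k => ambientWeight n k * u k) (irho n) =
      (1 - 2 * s) * u (irho n) := fun s => by
    simp [ambientWeight, irho]; ring
  have hp : ∀ (s : ℝ) (C : Fin n), (u + s • fun k => ambientWeight n k * u k) (ip C) =
      (1 - 2 * s) * u (ip C) := fun s C => by
    simp [ambientWeight, ip]; ring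
  have hx : ∀ s : ℝ, xc (u + s • fun k => ambientWeight n k * u k) = xc u := fun s => by
    funext A
    simp [ambientWeight, xc, ix]
  have h1 : HasDerivAt (fun s : ℝ => 1 + s) 1 0 := (hasDerivAt_id (0 : ℝ)).const_add 1
  have h2 : HasDerivAt (fun s : ℝ => 1 - 2 * s) (-2) 0 := by
    simpa using ((hasDerivAt_id (0 : ℝ)).const_mul 2).const_sub 1
  have of_factor : ∀ {f g : ℝ → ℝ} {g' a d : ℝ}, HasDerivAt g g' 0 →
      (∀ s, f s = g s * a) → g' * a = d → HasDerivAt f d 0 := by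
    intro f g g' a d hg hf hd
    rw [funext hf, ← hd]
    exact hg.mul_const a
  rcases i with _ | A | A | _ <;> rcases j with _ | B | B | _ <;>
    simp only [ambientMetric, Matrix.of_apply, ht, hr, hp, hx, mul_zero]
  case inl.inl => exact of_factor h2 (a := 2 * u (irho n)) (fun s => by ring) (by
    simp only [ambientWeight]; ring)
  case inr.inl.inr.inl =>
    refine of_factor ((h1.pow 2).mul h2)
      (a := u (it n) ^ 2 * (-2 * ∑ C, u (ip C) * Γ C A B (xc u)
        + 2 * u (irho n) / ((n : ℝ) - 1) * ricConn Γ A B (xc u)))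
      (fun s => ?_) (by simp only [ambientWeight]; norm_num)
    simp only [Pi.mul_apply, Pi.pow_apply, mul_assoc, ← Finset.mul_sum]
    ring
  all_goals first
    | exact hasDerivAt_const _ _
    | exact of_factor h1 (fun _ => rfl) (by simp only [ambientWeight]; ring)
    | exact of_factor (h1.pow 2) (a := u (it n) ^ 2 * if A = B then (1 : ℝ) else 0)
        (fun s => by simp only [Pi.pow_apply]; ring)
        (by simp only [ambientWeight]; norm_num)

/-- `K = t ∂_t − 2 p_A ∂_{p_A} − 2 ρ ∂_ρ` is a Killing field of
the ambient metric. -/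
theorem ambient_killing_field
    (n : ℕ) (hn : 2 ≤ n) (Γ : Fin n → Fin n → Fin n → (Fin n → ℝ) → ℝ)
    (hsmooth : ∀ C A B, ContDiff ℝ (⊤ : ℕ∞) (Γ C A B))
    (hsym : ∀ C A B x, Γ C A B x = Γ C B A x)
    (hvol : PreservesVolume n Γ) :
    ∀ u : AmbIdx n → ℝ, 0 < u (it n) → ∀ i j : AmbIdx n,
      lieDeriv (ambientKillingField n) (ambientMetric n Γ) i j u = 0 := by
  intro u _ i j
  rw [ambientKillingField_eq, lieDeriv_weighted,
    fderiv_apply_eq_of_hasDerivAt (differentiable_ambientMetric hsmooth i j u)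
      (hasDerivAt_ambientMetric_weighted Γ i j u)]
  ring
end

section
/- Let n ≥ 2 and let D be a torsion-free affine connection on ℝⁿ preserving a volume form, with Ricci curvature Ric_{AB}. Then the Thomas cone connection of D, the affine connection on C = ℝ_{>0} × ℝⁿ with coefficients Γ̂ given by Γ̂^C_{AB} = Γ^C_{AB}, Γ̂^0_{AB} = −(x^0/(n−1)) Ric_{AB}, Γ̂^B_{A0} = Γ̂^B_{0A} = δ^B_A / x^0, and all other coefficients zero, is Ricci-flat: its Ricci curvature (computed by the same coordinate formula as for D, with indices running over 0 and Fin n) vanishes identically on C. -/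
open scoped BigOperators

/-- Forgetting the radial coordinate of the cone has the coordinate projection as derivative. -/
lemma hasFDerivAt_cone_projection {n : ℕ} (u : ThIdx n → ℝ) :
    HasFDerivAt (fun w : ThIdx n → ℝ => fun E : Fin n => w (Sum.inr E))
      (ContinuousLinearMap.pi fun E : Fin n =>
        ContinuousLinearMap.proj (R := ℝ) (φ := fun _ : ThIdx n => ℝ) (Sum.inr E)) u :=
  (ContinuousLinearMap.pi fun E : Fin n =>
    ContinuousLinearMap.proj (R := ℝ) (φ := fun _ : ThIdx n => ℝ) (Sum.inr E)).hasFDerivAt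

lemma pd_inr_comp_projection {n : ℕ} {f : (Fin n → ℝ) → ℝ} (hf : Differentiable ℝ f)
    (A : Fin n) (u : ThIdx n → ℝ) :
    pd (Sum.inr A) (fun w : ThIdx n → ℝ => f (fun E => w (Sum.inr E))) u =
      pd A f (fun E => u (Sum.inr E)) := by
  have h := (hf (fun E => u (Sum.inr E))).hasFDerivAt.comp u (hasFDerivAt_cone_projection u)
  have h' := h.fderiv
  simp only [Function.comp_def] at h'
  rw [pd, pd, h', ContinuousLinearMap.comp_apply]
  congr 1
  ext E
  simp [Pi.single_apply]

lemma pd_inl_comp_projection {n : ℕ} {f : (Fin n → ℝ) → ℝ} (hf : Differentiable ℝ f)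
    (a : Unit) (u : ThIdx n → ℝ) :
    pd (Sum.inl a) (fun w : ThIdx n → ℝ => f (fun E => w (Sum.inr E))) u = 0 := by
  have h := (hf (fun E => u (Sum.inr E))).hasFDerivAt.comp u (hasFDerivAt_cone_projection u)
  have h' := h.fderiv
  simp only [Function.comp_def] at h'
  rw [pd, h', ContinuousLinearMap.comp_apply]
  have h0 : (ContinuousLinearMap.pi fun E : Fin n =>
      ContinuousLinearMap.proj (R := ℝ) (φ := fun _ : ThIdx n => ℝ) (Sum.inr E))
      (Pi.single (Sum.inl a) 1) = 0 := by
    ext E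
    simp
  rw [h0, map_zero]

/-- Derivatives of functions of the radial coordinate. -/
lemma pd_comp_radial {n : ℕ} {g : ℝ → ℝ} {g' : ℝ} {u : ThIdx n → ℝ}
    (hg : HasDerivAt g g' (u (Sum.inl ()))) (i : ThIdx n) :
    pd i (fun w : ThIdx n → ℝ => g (w (Sum.inl ()))) u =
      if i = Sum.inl () then g' else 0 := by
  have h := hg.comp_hasFDerivAt u
    (ContinuousLinearMap.proj (R := ℝ) (φ := fun _ : ThIdx n => ℝ) (Sum.inl ())).hasFDerivAt
  have h' := h.fderiv
  simp only [Function.comp_def, ContinuousLinearMap.proj_apply] at h'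
  rw [pd, h']
  rcases i with i | i <;> simp

lemma pd_zero {ι : Type} [Fintype ι] [DecidableEq ι] (i : ι) (x : ι → ℝ) :
    pd i (fun _ => (0 : ℝ)) x = 0 := by
  simp [pd]

lemma pd_radial_mul_comp_projection {n : ℕ} {f : (Fin n → ℝ) → ℝ} (hf : Differentiable ℝ f)
    (c : ℝ) (u : ThIdx n → ℝ) :
    pd (Sum.inl ()) (fun w : ThIdx n → ℝ =>
      -(w (Sum.inl ()) / c) * f (fun E => w (Sum.inr E))) u =
      -(1 / c) * f (fun E => u (Sum.inr E)) := by
  have hr : HasDerivAt (fun r : ℝ => -(r / c)) (-(1 / c)) (u (Sum.inl ())) :=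
    ((hasDerivAt_id _).div_const c).neg
  have h1 := pd_comp_radial hr (Sum.inl ())
  have h2 := pd_inl_comp_projection hf () u
  have d1 : DifferentiableAt ℝ (fun w : ThIdx n → ℝ => -(w (Sum.inl ()) / c)) u := by
    fun_prop
  have d2 : DifferentiableAt ℝ (fun w : ThIdx n → ℝ => f (fun E => w (Sum.inr E))) u :=
    (hf _).comp u (hasFDerivAt_cone_projection u).differentiableAt
  rw [pd] at h1 h2 ⊢
  rw [fderiv_fun_mul d1 d2]
  simp only [add_apply, smul_apply, smul_eq_mul, h1, h2, if_true]
  ring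

lemma ContDiff.pd {ι : Type} [Fintype ι] [DecidableEq ι] {f : (ι → ℝ) → ℝ}
    (hf : ContDiff ℝ (⊤ : ℕ∞) f) (i : ι) : ContDiff ℝ (⊤ : ℕ∞) (pd i f) :=
  (hf.fderiv_right (m := (⊤ : ℕ∞)) (by simp)).clm_apply contDiff_const

lemma ContDiff.ricConn {ι : Type} [Fintype ι] [DecidableEq ι]
    {Γ : ι → ι → ι → (ι → ℝ) → ℝ} (hΓ : ∀ k i j, ContDiff ℝ (⊤ : ℕ∞) (Γ k i j)) (i j : ι) :
    ContDiff ℝ (⊤ : ℕ∞) (ricConn Γ i j) := by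
  refine ContDiff.add (ContDiff.sub ?_ ?_) ?_
  · exact ContDiff.sum fun k _ => (hΓ k i j).pd k
  · exact ContDiff.sum fun k _ => (hΓ k k j).pd i
  · exact ContDiff.sum fun k _ => ContDiff.sum fun l _ =>
      ((hΓ k k l).mul (hΓ l i j)).sub ((hΓ k i l).mul (hΓ l k j))

lemma pd_one_div_radial {n : ℕ} {u : ThIdx n → ℝ} (hu : u (Sum.inl ()) ≠ 0) (i : ThIdx n) :
    pd i (fun w : ThIdx n → ℝ => 1 / w (Sum.inl ())) u =
      if i = Sum.inl () then -(1 / u (Sum.inl ()) ^ 2) else 0 := by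
  have hr : HasDerivAt (fun r : ℝ => 1 / r) (-(1 / u (Sum.inl ()) ^ 2)) (u (Sum.inl ())) := by
    simpa using hasDerivAt_inv hu
  exact pd_comp_radial hr i

lemma pd_inr_ite_one_div_radial {n : ℕ} {u : ThIdx n → ℝ} (hu : u (Sum.inl ()) ≠ 0)
    (p : Prop) [Decidable p] (A : Fin n) :
    pd (Sum.inr A) (fun w : ThIdx n → ℝ => if p then 1 / w (Sum.inl ()) else 0) u = 0 := by
  by_cases hp : p
  · simp only [hp, if_true, pd_one_div_radial hu, reduceCtorEq, if_false]
  · simp only [hp, if_false, pd_zero]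

lemma ricConn_thomasConn_inl_inl {n : ℕ} (Γ : Fin n → Fin n → Fin n → (Fin n → ℝ) → ℝ)
    {u : ThIdx n → ℝ} (hu : u (Sum.inl ()) ≠ 0) :
    ricConn (thomasConn n Γ) (Sum.inl ()) (Sum.inl ()) u = 0 := by
  simp [ricConn, thomasConn, Fintype.sum_sum_type, pd_zero, pd_one_div_radial hu, -one_div]
  ring

lemma ricConn_thomasConn_inl_inr {n : ℕ} {Γ : Fin n → Fin n → Fin n → (Fin n → ℝ) → ℝ}
    (hΓ : ∀ C A B, Differentiable ℝ (Γ C A B)) {u : ThIdx n → ℝ} (hu : u (Sum.inl ()) ≠ 0)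
    (B : Fin n) : ricConn (thomasConn n Γ) (Sum.inl ()) (Sum.inr B) u = 0 := by
  simp [ricConn, thomasConn, Fintype.sum_sum_type, pd_zero, pd_inr_ite_one_div_radial hu,
    pd_inl_comp_projection (hΓ _ _ _), mul_comm, -one_div]

lemma ricConn_thomasConn_inr_inl {n : ℕ} {Γ : Fin n → Fin n → Fin n → (Fin n → ℝ) → ℝ}
    (hsym : ∀ C A B x, Γ C A B x = Γ C B A x) {u : ThIdx n → ℝ} (hu : u (Sum.inl ()) ≠ 0)
    (A : Fin n) : ricConn (thomasConn n Γ) (Sum.inr A) (Sum.inl ()) u = 0 := by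
  simp [ricConn, thomasConn, Fintype.sum_sum_type, pd_zero, pd_one_div_radial hu,
    pd_inr_ite_one_div_radial hu, -one_div]
  exact sub_eq_zero.mpr (Finset.sum_congr rfl fun C _ => by rw [hsym C C A])

lemma ricConn_thomasConn_inr_inr {n : ℕ} {Γ : Fin n → Fin n → Fin n → (Fin n → ℝ) → ℝ}
    (hn : (n : ℝ) - 1 ≠ 0) (hΓ : ∀ C A B, Differentiable ℝ (Γ C A B))
    (hR : ∀ A B, Differentiable ℝ (ricConn Γ A B)) {u : ThIdx n → ℝ}
    (hu : u (Sum.inl ()) ≠ 0) (A B : Fin n) :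
    ricConn (thomasConn n Γ) (Sum.inr A) (Sum.inr B) u = 0 := by
  have hric : ricConn Γ A B (fun E => u (Sum.inr E)) = _ := rfl
  conv_rhs at hric => rw [ricConn]
  rw [ricConn]
  simp only [Finset.sum_sub_distrib] at hric
  simp [thomasConn, Fintype.sum_sum_type, pd_zero, pd_radial_mul_comp_projection (hR _ _),
    pd_inr_comp_projection (hΓ _ _ _), -one_div, -neg_mul]
  simp only [Finset.sum_add_distrib, Finset.sum_const, Finset.card_univ, Fintype.card_fin,
    nsmul_eq_mul, Finset.sum_ite_eq, Finset.mem_univ, if_true]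
  set R := ricConn Γ A B (fun E => u (Sum.inr E))
  have hcoef : -(1 / ((n : ℝ) - 1)) * R + R
      + n * (1 / u (Sum.inl ()) * (-(u (Sum.inl ()) / (n - 1)) * R))
      - (-(u (Sum.inl ()) / (n - 1)) * R * (1 / u (Sum.inl ()))
        + 1 / u (Sum.inl ()) * (-(u (Sum.inl ()) / (n - 1)) * R)) = 0 := by
    field_simp
    ring
  linarith

/-- The Thomas cone connection of a volume-preserving
torsion-free affine connection is Ricci-flat on the cone `C = ℝ_{>0} × ℝⁿ`. -/
theorem thomas_cone_connection_ricci_flat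
    (n : ℕ) (hn : 2 ≤ n) (Γ : Fin n → Fin n → Fin n → (Fin n → ℝ) → ℝ)
    (hsmooth : ∀ C A B, ContDiff ℝ (⊤ : ℕ∞) (Γ C A B))
    (hsym : ∀ C A B x, Γ C A B x = Γ C B A x)
    (hvol : PreservesVolume n Γ) :
    ∀ u : ThIdx n → ℝ, 0 < u (Sum.inl ()) →
      ∀ i j : ThIdx n, ricConn (thomasConn n Γ) i j u = 0 := by
  intro u hu i j
  have hu' : u (Sum.inl ()) ≠ 0 := hu.ne'
  have hn' : (n : ℝ) - 1 ≠ 0 := by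
    have : (2 : ℝ) ≤ n := by exact_mod_cast hn
    linarith
  have hd : ∀ C A B, Differentiable ℝ (Γ C A B) := fun C A B =>
    (hsmooth C A B).differentiable (by simp)
  have hR : ∀ A B, Differentiable ℝ (ricConn Γ A B) := fun A B =>
    (ContDiff.ricConn hsmooth A B).differentiable (by simp)
  rcases i with ⟨⟩ | A <;> rcases j with ⟨⟩ | B
  · exact ricConn_thomasConn_inl_inl Γ hu'
  · exact ricConn_thomasConn_inl_inr hd hu' B
  · exact ricConn_thomasConn_inr_inl hsym hu' A
  · exact ricConn_thomasConn_inr_inr hn' hd hR hu' A B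
end
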